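/- Let η > 0, let h₁, h₂ ∈ ℝ[x] be cubic polynomials, fix a real number c > 1, and let ε > 0. Then there exists a constant C > 0 such that for every real P ≥ 2, the number S₄ of integer quadruples (x₁, y₁, x₂, y₂) with P < x₁, y₁ ≤ cP, P^{4/5} < x₂, y₂ ≤ 2P^{4/5}, and |h₁(x₁) − h₁(y₁) + h₂(x₂) − h₂(y₂)| < η satisfies S₄ ≤ C P^{9/5 + ε}. -/

import Mathlib

/-- The divisor function satisfies `d(n) ≪ n ^ ε`. -/
theorem exists_card_divisors_le_mul_rpow {ε : ℝ} (hε : 0 < ε) :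
    ∃ C : ℝ, 0 < C ∧ ∀ n : ℕ, n ≠ 0 → (n.divisors.card : ℝ) ≤ C * (n : ℝ) ^ ε := by
  have hlog : 0 < Real.log 2 := Real.log_pos (by norm_num)
  set C₀ : ℝ := max 1 (1 / (ε * Real.log 2)) with hC₀
  have hC₀1 : 1 ≤ C₀ := le_max_left _ _
  have hC₀2 : 1 ≤ C₀ * (ε * Real.log 2) := by
    have h : 1 / (ε * Real.log 2) ≤ C₀ := le_max_right _ _
    rwa [div_le_iff₀ (by positivity)] at h
  set B : ℕ := ⌈(2 : ℝ) ^ (1 / ε)⌉₊ with hB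
  refine ⟨C₀ ^ B, by positivity, fun n hn => ?_⟩
  have key : ∀ p ∈ n.primeFactors, ((n.factorization p + 1 : ℕ) : ℝ) ≤
      (if p < B then C₀ else 1) * ((p : ℝ) ^ n.factorization p) ^ ε := by
    intro p hp
    have hp2 : (2 : ℝ) ≤ p := by exact_mod_cast (Nat.prime_of_mem_primeFactors hp).two_le
    generalize n.factorization p = k
    rw [← Real.rpow_natCast, ← Real.rpow_mul (by positivity), mul_comm (k : ℝ) ε]
    push_cast
    split_ifs with h
    · have h1 : (2 : ℝ) ^ (ε * k) ≤ (p : ℝ) ^ (ε * k) :=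
        Real.rpow_le_rpow (by norm_num) hp2 (by positivity)
      have h2 : Real.log 2 * (ε * k) + 1 ≤ (2 : ℝ) ^ (ε * k) := by
        rw [Real.rpow_def_of_pos (by norm_num)]
        exact Real.add_one_le_exp _
      have hk : (0 : ℝ) ≤ k := by positivity
      nlinarith [mul_le_mul_of_nonneg_left (h2.trans h1) (by positivity : 0 ≤ C₀)]
    · have h1 : (2 : ℝ) ≤ (p : ℝ) ^ ε := by
        have : (2 : ℝ) ^ (1 / ε) ≤ p := (Nat.le_ceil _).trans (by exact_mod_cast not_lt.mp h)
        calc (2 : ℝ) = ((2 : ℝ) ^ (1 / ε)) ^ ε := by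
              rw [← Real.rpow_mul (by norm_num), one_div_mul_cancel hε.ne', Real.rpow_one]
          _ ≤ _ := Real.rpow_le_rpow (by positivity) this hε.le
      rw [one_mul, Real.rpow_mul (by positivity), Real.rpow_natCast]
      calc (k : ℝ) + 1 ≤ 2 ^ k := by exact_mod_cast Nat.lt_two_pow_self
        _ ≤ _ := pow_le_pow_left₀ (by norm_num) h1 k
  rw [Nat.card_divisors hn]
  calc ((∏ p ∈ n.primeFactors, (n.factorization p + 1) : ℕ) : ℝ)
      ≤ ∏ p ∈ n.primeFactors,
          ((if p < B then C₀ else 1) * ((p : ℝ) ^ n.factorization p) ^ ε) := by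
        rw [Nat.cast_prod]
        exact Finset.prod_le_prod (fun _ _ => by positivity) key
    _ = C₀ ^ (n.primeFactors.filter (· < B)).card * (n : ℝ) ^ ε := by
        rw [Finset.prod_mul_distrib, Finset.prod_ite]
        simp only [Finset.prod_const, one_pow, mul_one]
        rw [Real.finsetProd_rpow _ _ (fun _ _ => by positivity)]
        congr 2
        conv_rhs => rw [← Nat.prod_factorization_pow_eq_self hn]
        simp [Finsupp.prod]
    _ ≤ C₀ ^ B * (n : ℝ) ^ ε := by
        gcongr
        calc _ ≤ (Finset.range B).card := Finset.card_le_card fun p hp => by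
              simpa using (Finset.mem_filter.mp hp).2
          _ = B := by simp

/-- A finite set whose fibres under a map into `T` have at most `r` elements has at most
`r * #T` elements. -/
theorem Finset.card_le_mul_card_of_fiber_le {ι κ : Type*} [DecidableEq κ] {S : Finset ι}
    {T : Finset κ} {φ : ι → κ} {r : ℝ} (hφ : ∀ s ∈ S, φ s ∈ T)
    (hr : ∀ k ∈ T, ((S.filter (φ · = k)).card : ℝ) ≤ r) : (S.card : ℝ) ≤ r * T.card := by
  rw [Finset.card_eq_sum_card_fiberwise hφ, Nat.cast_sum, mul_comm, ← nsmul_eq_mul]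
  exact Finset.sum_le_card_nsmul _ _ _ hr

/-- Cauchy-Schwarz: the number of pairs in a common fibre of a map `S → T` is at least
`#S ^ 2 / #T`. -/
theorem Finset.card_sq_le_card_mul_card_filter {ι κ : Type*} [DecidableEq κ] [DecidableEq ι]
    {S : Finset ι} {T : Finset κ} {φ : ι → κ} (hφ : ∀ s ∈ S, φ s ∈ T) :
    S.card ^ 2 ≤ T.card * ((S ×ˢ S).filter fun q => φ q.1 = φ q.2).card := by
  have h : ((S ×ˢ S).filter fun q => φ q.1 = φ q.2).card
      = ∑ k ∈ T, (S.filter (φ · = k)).card ^ 2 := by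
    rw [Finset.card_eq_sum_card_fiberwise (f := fun q => φ q.1) (t := T)]
    · refine Finset.sum_congr rfl fun k _ => ?_
      rw [sq, ← Finset.card_product]
      congr 1
      ext ⟨p, q⟩
      simp only [Finset.mem_filter, Finset.mem_product]
      grind
    · intro q hq
      simp only [Finset.coe_filter, Finset.mem_product, Set.mem_ofPred_eq] at hq
      exact hφ _ hq.1.1
  rw [h, Finset.card_eq_sum_card_fiberwise hφ]
  exact sq_sum_le_card_mul_sum_sq

/-- The integers in the real interval `(a, b]`. -/
noncomputable def intIoc (a b : ℝ) : Finset ℤ := Finset.Ioc ⌊a⌋ ⌊b⌋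

theorem mem_intIoc {a b : ℝ} {n : ℤ} : n ∈ intIoc a b ↔ a < n ∧ (n : ℝ) ≤ b := by
  simp [intIoc, Int.floor_lt, Int.le_floor]

theorem card_intIoc_le {a b : ℝ} (hab : a ≤ b + 1) : ((intIoc a b).card : ℝ) ≤ b - a + 1 := by
  have h1 := Int.floor_le b
  have h2 := Int.lt_floor_add_one a
  rw [intIoc, Int.card_Ioc, ← Int.cast_natCast, Int.toNat_eq_max]
  push_cast
  exact max_le (by linarith) (by linarith)

theorem Polynomial.exists_eval_eq_of_degree_eq_three {h : Polynomial ℝ} (hdeg : h.degree = 3) :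
    ∃ a b e k : ℝ, a ≠ 0 ∧ ∀ x, h.eval x = a * x ^ 3 + b * x ^ 2 + e * x + k := by
  have hn : h.natDegree = 3 := Polynomial.natDegree_eq_of_degree_eq_some hdeg
  refine ⟨h.coeff 3, h.coeff 2, h.coeff 1, h.coeff 0, ?_, fun x => ?_⟩
  · rw [← hn]
    exact Polynomial.leadingCoeff_ne_zero.mpr (by rintro rfl; simp at hn)
  · rw [Polynomial.eval_eq_sum_range, hn]
    simp [Finset.sum_range_succ]
    ring

/-- A real cubic expands distances by a factor `≫ X ^ 2` on `(X, ∞)`. -/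
theorem cubic_sub_lower {a b e k : ℝ} (ha : a ≠ 0) {f : ℝ → ℝ}
    (hf : ∀ x, f x = a * x ^ 3 + b * x ^ 2 + e * x + k) :
    ∀ᶠ X : ℝ in Filter.atTop, ∀ x y, X < x → X < y → |a| * X ^ 2 * |x - y| ≤ |f x - f y| := by
  have ha' : 0 < |a| := abs_pos.mpr ha
  filter_upwards [Filter.eventually_ge_atTop 1, Filter.eventually_ge_atTop (4 * |b| / |a|),
    Filter.eventually_ge_atTop (4 * |e| / |a|)] with X h1 h2 h3 x y hx hy
  rw [div_le_iff₀ ha'] at h2 h3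
  have hfac : f x - f y = (a * (x ^ 2 + x * y + y ^ 2) + (b * (x + y) + e)) * (x - y) := by
    rw [hf, hf]; ring
  rw [hfac, abs_mul]
  gcongr
  set s := x + y with hs
  have hs2 : 2 * X ≤ s := by linarith
  have e1 : |a| * (3 / 4 * s ^ 2) ≤ |a * (x ^ 2 + x * y + y ^ 2)| := by
    rw [abs_mul]
    gcongr
    exact le_trans (by nlinarith [sq_nonneg (x - y)]) (le_abs_self _)
  have e2 : |b * s + e| ≤ |b| * s + |e| := by
    refine (abs_add_le _ _).trans ?_
    rw [abs_mul, abs_of_pos (by linarith : 0 < s)]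
  have hs3 : X * s ≤ s ^ 2 := by nlinarith
  have hs4 : (2 * X) ^ 2 ≤ s ^ 2 := by gcongr
  have hs5 : X ≤ s ^ 2 := by nlinarith
  have e3 : |b| * s ≤ 1 / 4 * |a| * s ^ 2 := by
    linarith [mul_le_mul_of_nonneg_right h2 (by linarith : 0 ≤ s),
      mul_le_mul_of_nonneg_left hs3 ha'.le]
  have e4 : |e| ≤ 1 / 4 * |a| * s ^ 2 := by linarith [mul_le_mul_of_nonneg_left hs5 ha'.le]
  have e5 : |a| * X ^ 2 ≤ 1 / 4 * |a| * s ^ 2 := by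
    linarith [mul_le_mul_of_nonneg_left hs4 ha'.le]
  have e6 := abs_sub_abs_le_abs_sub (a * (x ^ 2 + x * y + y ^ 2)) (-(b * s + e))
  rw [abs_neg, sub_neg_eq_add] at e6
  linarith

/-- A real cubic is `O(X ^ 2)`-Lipschitz on `[-X, X]`. -/
theorem cubic_sub_upper {a b e k : ℝ} {f : ℝ → ℝ}
    (hf : ∀ x, f x = a * x ^ 3 + b * x ^ 2 + e * x + k) {X x y : ℝ} (hX : 1 ≤ X)
    (hx : |x| ≤ X) (hy : |y| ≤ X) :
    |f x - f y| ≤ (3 * |a| + 2 * |b| + |e|) * X ^ 2 * |x - y| := by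
  have hfac : f x - f y = (a * (x ^ 2 + x * y + y ^ 2) + b * (x + y) + e) * (x - y) := by
    rw [hf, hf]; ring
  rw [hfac, abs_mul]
  gcongr
  have hxy : |x * y| ≤ X ^ 2 := by rw [abs_mul, sq]; gcongr
  have e1 : |a * (x ^ 2 + x * y + y ^ 2)| ≤ |a| * (3 * X ^ 2) := by
    rw [abs_mul]
    gcongr
    have hx2 := sq_le_sq' (abs_le.mp hx).1 (abs_le.mp hx).2
    have hy2 := sq_le_sq' (abs_le.mp hy).1 (abs_le.mp hy).2
    rw [abs_le] at hxy ⊢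
    constructor <;> nlinarith [sq_nonneg x, sq_nonneg y]
  have e2 : |b * (x + y)| ≤ |b| * (2 * X ^ 2) := by
    rw [abs_mul]
    gcongr
    refine (abs_add_le _ _).trans ?_
    nlinarith
  have e3 : |e| ≤ |e| * X ^ 2 := le_mul_of_one_le_right (abs_nonneg _) (by nlinarith)
  refine (abs_add_three _ _ _).trans ?_
  linarith

theorem linear_form_bounds {α : ℝ} (hα : α ≠ 0) (β c : ℝ) :
    ∀ᶠ t : ℝ in Filter.atTop, ∀ z ∈ intIoc (2 * t ^ 5) (2 * c * t ^ 5),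
      |α| * t ^ 5 ≤ |α * z + β| ∧ |α * z + β| ≤ (2 * c + 1) * |α| * t ^ 5 := by
  have hα' : 0 < |α| := abs_pos.mpr hα
  filter_upwards [Filter.eventually_ge_atTop 1, Filter.eventually_ge_atTop (|β| / |α|)]
    with t h1 h2 z hz
  rw [mem_intIoc] at hz
  rw [div_le_iff₀ hα'] at h2
  have ht : t ≤ t ^ 5 := le_self_pow₀ h1 (by norm_num)
  have hβ : |β| ≤ |α| * t ^ 5 := by nlinarith
  have hz0 : (0 : ℝ) < z := lt_trans (by positivity) hz.1
  have hαz : |α * z| = |α| * z := by rw [abs_mul, abs_of_pos hz0]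
  have h3 := abs_sub_abs_le_abs_sub (α * z) (-β)
  have h4 := abs_add_le (α * z) β
  rw [abs_neg, sub_neg_eq_add] at h3
  rw [hαz] at h3 h4
  have h5 := mul_le_mul_of_nonneg_left hz.1.le hα'.le
  have h6 := mul_le_mul_of_nonneg_left hz.2 hα'.le
  constructor <;> linarith

/-- Three integer points very close to the hyperbola `n (α z + β) = N` cannot have abscissae in a
short interval: their determinant would vanish, contradicting the curvature of the hyperbola. -/
theorem not_three_close_points_near_hyperbola {α : ℝ} (hα : α ≠ 0) (β : ℝ) {c η κ K : ℝ}
    (hc : 1 < c) (hη : 0 < η) (hκ : 0 < κ) (hK : 0 < K) :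
    ∃ δ : ℝ, 0 < δ ∧ ∀ᶠ t : ℝ in Filter.atTop, ∀ N : ℝ, κ * t ^ 11 ≤ |N| → |N| ≤ K * t ^ 12 →
      ∀ z₁ ∈ intIoc (2 * t ^ 5) (2 * c * t ^ 5), ∀ z₂ ∈ intIoc (2 * t ^ 5) (2 * c * t ^ 5),
      ∀ z₃ ∈ intIoc (2 * t ^ 5) (2 * c * t ^ 5), ∀ n₁ n₂ n₃ : ℤ,
      |n₁ * (α * z₁ + β) - N| < 2 * η → |n₂ * (α * z₂ + β) - N| < 2 * η →
      |n₃ * (α * z₃ + β) - N| < 2 * η → z₁ ≠ z₂ → z₂ ≠ z₃ → z₃ ≠ z₁ →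
      |(z₁ : ℝ) - z₂| ≤ δ * t → |(z₂ : ℝ) - z₃| ≤ δ * t → |(z₃ : ℝ) - z₁| ≤ δ * t → False := by
  have hα' : 0 < |α| := abs_pos.mpr hα
  refine ⟨min 1 (|α| / (4 * K)), by positivity, ?_⟩
  set δ : ℝ := min 1 (|α| / (4 * K)) with hδ
  have hδ0 : 0 < δ := by positivity
  have hδ1 : δ ≤ 1 := min_le_left _ _
  have hδ2 : δ * (4 * K) ≤ |α| := (le_div_iff₀ (by positivity)).mp (min_le_right _ _)
  filter_upwards [linear_form_bounds hα β c, Filter.eventually_ge_atTop 1,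
    Filter.eventually_ge_atTop (24 * η * (2 * c + 1) ^ 2 / |α|),
    Filter.eventually_gt_atTop (6 * η * (2 * c + 1) ^ 2 / κ)]
    with t hw ht1 ht2 ht3 N hN1 hN2 z₁ hz₁ z₂ hz₂ z₃ hz₃ n₁ n₂ n₃ hn₁ hn₂ hn₃ h12 h23 h31 d12 d23 d31
  rw [div_le_iff₀ hα'] at ht2
  rw [div_lt_iff₀ hκ] at ht3
  have ht0 : 0 < t := by linarith
  obtain ⟨l₁, u₁⟩ := hw z₁ hz₁
  obtain ⟨l₂, u₂⟩ := hw z₂ hz₂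
  obtain ⟨l₃, u₃⟩ := hw z₃ hz₃
  set w₁ : ℝ := α * z₁ + β with hw₁
  set w₂ : ℝ := α * z₂ + β with hw₂
  set w₃ : ℝ := α * z₃ + β with hw₃
  set M : ℝ := (2 * c + 1) * |α| * t ^ 5 with hM
  set V : ℝ := |(z₁ : ℝ) - z₂| * |(z₂ : ℝ) - z₃| * |(z₃ : ℝ) - z₁| with hV
  set D : ℤ := n₁ * (z₂ - z₃) + n₂ * (z₃ - z₁) + n₃ * (z₁ - z₂) with hD
  set E : ℝ := (n₁ * w₁ - N) * (w₂ * w₃) * (z₂ - z₃) + (n₂ * w₂ - N) * (w₃ * w₁) * (z₃ - z₁)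
    + (n₃ * w₃ - N) * (w₁ * w₂) * (z₁ - z₂) with hE
  have hident : (D : ℝ) * (w₁ * w₂ * w₃)
      = -(α ^ 2 * (((z₁ : ℝ) - z₂) * (z₂ - z₃) * (z₃ - z₁)) * N) + E := by
    rw [hD, hE, hw₁, hw₂, hw₃]
    push_cast
    ring
  have habs : |α ^ 2 * (((z₁ : ℝ) - z₂) * (z₂ - z₃) * (z₃ - z₁)) * N| = |α| ^ 2 * V * |N| := by
    simp only [abs_mul, abs_pow, hV]
  have hMM : ∀ x y : ℝ, |x| ≤ M → |y| ≤ M → |x * y| ≤ M ^ 2 := fun x y hx hy => by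
    rw [abs_mul, sq]; gcongr
  have hEb : |E| ≤ 2 * η * M ^ 2 * (|(z₂ : ℝ) - z₃| + |(z₃ : ℝ) - z₁| + |(z₁ : ℝ) - z₂|) := by
    have hterm : ∀ θ x y r : ℝ, |θ| < 2 * η → |x| ≤ M → |y| ≤ M →
        |θ * (x * y) * r| ≤ 2 * η * M ^ 2 * |r| := fun θ x y r hθ hx hy => by
      rw [abs_mul, abs_mul]
      gcongr
      exact hMM x y hx hy
    refine (abs_add_three _ _ _).trans ?_
    refine (add_le_add (add_le_add (hterm _ _ _ _ hn₁ u₂ u₃) (hterm _ _ _ _ hn₂ u₃ u₁))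
      (hterm _ _ _ _ hn₃ u₁ u₂)).trans_eq ?_
    ring
  have hone : ∀ x y : ℤ, x ≠ y → (1 : ℝ) ≤ |(x : ℝ) - y| := fun x y hxy => by
    exact_mod_cast Int.one_le_abs (sub_ne_zero.mpr hxy)
  have o12 := hone _ _ h12
  have o23 := hone _ _ h23
  have o31 := hone _ _ h31
  have hVle : V ≤ (δ * t) ^ 3 := by
    rw [hV, pow_three']
    exact mul_le_mul (mul_le_mul d12 d23 (abs_nonneg _) (by positivity)) d31 (abs_nonneg _)
      (by positivity)
  have hV0 : 0 < V := by positivity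
  have hsumV : |(z₂ : ℝ) - z₃| + |(z₃ : ℝ) - z₁| + |(z₁ : ℝ) - z₂| ≤ 3 * V := by
    have p1 := one_le_mul_of_one_le_of_one_le o12 o23
    have p2 := one_le_mul_of_one_le_of_one_le o12 o31
    have p3 := one_le_mul_of_one_le_of_one_le o23 o31
    have q1 := le_mul_of_one_le_right (abs_nonneg ((z₃ : ℝ) - z₁)) p1
    have q2 := le_mul_of_one_le_right (abs_nonneg ((z₂ : ℝ) - z₃)) p2
    have q3 := le_mul_of_one_le_right (abs_nonneg ((z₁ : ℝ) - z₂)) p3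
    linarith
  have ht4 : t ≤ t ^ 4 := le_self_pow₀ ht1 (by norm_num)
  have hlow : |α| ^ 3 * t ^ 15 ≤ |w₁ * w₂ * w₃| := by
    rw [abs_mul, abs_mul]
    calc |α| ^ 3 * t ^ 15 = (|α| * t ^ 5) * (|α| * t ^ 5) * (|α| * t ^ 5) := by ring
      _ ≤ _ := by gcongr
  have hD0 : D = 0 := by
    by_contra hne
    have hD1 : (1 : ℝ) ≤ |(D : ℝ)| := by exact_mod_cast Int.one_le_abs hne
    have h1 : |α| ^ 2 * V * |N| ≤ |α| ^ 3 * t ^ 15 / 4 := by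
      have hδ3 : δ ^ 3 ≤ δ := pow_le_of_le_one hδ0.le hδ1 (by norm_num)
      calc |α| ^ 2 * V * |N| ≤ |α| ^ 2 * (δ * t) ^ 3 * (K * t ^ 12) := by gcongr
        _ = |α| ^ 2 * t ^ 15 * (δ ^ 3 * (4 * K)) / 4 := by ring
        _ ≤ |α| ^ 2 * t ^ 15 * (δ * (4 * K)) / 4 := by gcongr
        _ ≤ |α| ^ 2 * t ^ 15 * |α| / 4 := by gcongr
        _ = _ := by ring
    have h2 : |E| ≤ |α| ^ 3 * t ^ 15 / 4 := by
      calc |E| ≤ 2 * η * M ^ 2 * (δ * t + δ * t + δ * t) := hEb.trans (by gcongr)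
        _ ≤ 2 * η * M ^ 2 * (1 * t + 1 * t + 1 * t) := by gcongr
        _ = |α| ^ 2 * t ^ 11 * (24 * η * (2 * c + 1) ^ 2) / 4 := by rw [hM]; ring
        _ ≤ |α| ^ 2 * t ^ 11 * (t ^ 4 * |α|) / 4 := by
            have ht5 : 24 * η * (2 * c + 1) ^ 2 ≤ t ^ 4 * |α| := ht2.trans (by gcongr)
            exact div_le_div_of_nonneg_right (mul_le_mul_of_nonneg_left ht5 (by positivity))
              (by norm_num)
        _ = _ := by ring
    have h3 : |(D : ℝ) * (w₁ * w₂ * w₃)| ≤ |α| ^ 2 * V * |N| + |E| := by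
      rw [hident]
      refine (abs_add_le _ _).trans ?_
      rw [abs_neg, habs]
    rw [abs_mul] at h3
    have h4 : |α| ^ 3 * t ^ 15 ≤ |(D : ℝ)| * |w₁ * w₂ * w₃| :=
      hlow.trans (le_mul_of_one_le_left (abs_nonneg _) hD1)
    have h5 : 0 < |α| ^ 3 * t ^ 15 := by positivity
    linarith
  have hmain : |α| ^ 2 * V * |N| = |E| := by
    rw [hD0, Int.cast_zero, zero_mul] at hident
    rw [← habs]
    congr 1
    linarith
  have hlt : |E| < |α| ^ 2 * V * |N| := by
    calc |E| ≤ 2 * η * M ^ 2 * (3 * V) := hEb.trans (by gcongr)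
      _ = |α| ^ 2 * V * (t ^ 10 * (6 * η * (2 * c + 1) ^ 2)) := by rw [hM]; ring
      _ < |α| ^ 2 * V * (t ^ 10 * (t * κ)) := by gcongr
      _ = |α| ^ 2 * V * (κ * t ^ 11) := by ring
      _ ≤ _ := by gcongr
  linarith

theorem card_near_hyperbola_le {α : ℝ} (hα : α ≠ 0) (β : ℝ) {c η κ K : ℝ}
    (hc : 1 < c) (hη : 0 < η) (hκ : 0 < κ) (hK : 0 < K) :
    ∃ C : ℝ, 0 < C ∧ ∀ᶠ t : ℝ in Filter.atTop, ∀ N : ℝ, κ * t ^ 11 ≤ |N| → |N| ≤ K * t ^ 12 →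
      ∀ Z : Finset ℤ, (∀ z ∈ Z, z ∈ intIoc (2 * t ^ 5) (2 * c * t ^ 5) ∧
        ∃ n : ℤ, |n * (α * z + β) - N| < 2 * η) → (Z.card : ℝ) ≤ C * t ^ 4 := by
  obtain ⟨δ, hδ, h⟩ := not_three_close_points_near_hyperbola hα β hc hη hκ hK
  refine ⟨2 * (2 * c / δ + 1), by positivity, ?_⟩
  filter_upwards [h, Filter.eventually_ge_atTop 1] with t h ht1 N hN1 hN2 Z hZ
  have ht0 : 0 < t := by linarith
  have hmaps : ∀ z ∈ Z, ⌊(z : ℝ) / (δ * t)⌋ ∈ Finset.Icc 0 ⌊2 * c * t ^ 4 / δ⌋ := fun z hz => by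
    have hz' := mem_intIoc.mp (hZ z hz).1
    have hz0 : (0 : ℝ) < z := lt_trans (by positivity) hz'.1
    rw [Finset.mem_Icc]
    refine ⟨Int.floor_nonneg.mpr (by positivity), Int.floor_le_floor ?_⟩
    rw [div_le_div_iff₀ (by positivity) hδ]
    calc z * δ ≤ 2 * c * t ^ 5 * δ := by gcongr; exact hz'.2
      _ = _ := by ring
  have hcard : ((Finset.Icc 0 ⌊2 * c * t ^ 4 / δ⌋).card : ℝ) ≤ (2 * c / δ + 1) * t ^ 4 := by
    have h0 : 0 ≤ ⌊2 * c * t ^ 4 / δ⌋ := Int.floor_nonneg.mpr (by positivity)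
    have h1 := Int.floor_le (2 * c * t ^ 4 / δ)
    rw [Int.card_Icc, ← Int.cast_natCast, Int.toNat_of_nonneg (by linarith)]
    push_cast
    have h2 : 1 ≤ t ^ 4 := one_le_pow₀ ht1
    calc _ ≤ 2 * c * t ^ 4 / δ + t ^ 4 := by linarith
      _ = _ := by ring
  refine (Finset.card_le_mul_card_of_fiber_le hmaps (r := 2) fun k _ => ?_).trans ?_
  · by_contra! hlt
    obtain ⟨z₁, h₁, z₂, h₂, z₃, h₃, h12, h13, h23⟩ :=
      Finset.two_lt_card.mp (by exact_mod_cast hlt)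
    rw [Finset.mem_filter] at h₁ h₂ h₃
    obtain ⟨m₁, n₁, hn₁⟩ := hZ z₁ h₁.1
    obtain ⟨m₂, n₂, hn₂⟩ := hZ z₂ h₂.1
    obtain ⟨m₃, n₃, hn₃⟩ := hZ z₃ h₃.1
    have hclose : ∀ x y : ℤ, ⌊(x : ℝ) / (δ * t)⌋ = k → ⌊(y : ℝ) / (δ * t)⌋ = k →
        |(x : ℝ) - y| ≤ δ * t := fun x y hx hy => by
      have hxy := (Int.abs_sub_lt_one_of_floor_eq_floor (hx.trans hy.symm)).le
      rwa [← sub_div, abs_div, abs_of_pos (by positivity : 0 < δ * t),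
        div_le_one (by positivity)] at hxy
    exact h N hN1 hN2 z₁ m₁ z₂ m₂ z₃ m₃ n₁ n₂ n₃ hn₁ hn₂ hn₃ h12 h23 h13.symm
      (hclose _ _ h₁.2 h₂.2) (hclose _ _ h₂.2 h₃.2) (hclose _ _ h₃.2 h₁.2)
  · linarith

theorem card_triples_near_hyperbola_le {α : ℝ} (hα : α ≠ 0) (β : ℝ) {c η a b e k : ℝ}
    (hc : 1 < c) (hη : 0 < η) (ha : a ≠ 0) {g : ℝ → ℝ}
    (hg : ∀ x, g x = a * x ^ 3 + b * x ^ 2 + e * x + k) :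
    ∃ C : ℝ, 0 < C ∧ ∀ᶠ t : ℝ in Filter.atTop, ∀ W : Finset (ℤ × ℤ × ℤ),
      (∀ w ∈ W, w.1 ∈ intIoc (t ^ 4) (2 * t ^ 4) ∧ w.2.1 ∈ intIoc (t ^ 4) (2 * t ^ 4) ∧
        w.2.2 ∈ intIoc (2 * t ^ 5) (2 * c * t ^ 5) ∧
        ∃ n : ℤ, |n * (α * w.2.2 + β) - (g w.1 - g w.2.1)| < 2 * η) →
      (W.card : ℝ) ≤ C * t ^ 12 := by
  have ha' : 0 < |a| := abs_pos.mpr ha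
  set K : ℝ := 4 * (3 * |a| + 2 * |b| + |e|) with hK
  obtain ⟨C, hC, h⟩ := card_near_hyperbola_le hα β hc hη ha' (by positivity : 0 < K)
  refine ⟨16 * c + 4 * C, by positivity, ?_⟩
  filter_upwards [h, Filter.eventually_ge_atTop 1,
    (Filter.tendsto_pow_atTop (α := ℝ) (by norm_num : 4 ≠ 0)).eventually (cubic_sub_lower ha hg)]
    with t h ht1 hlow W hW
  have hcardJ : ((intIoc (t ^ 4) (2 * t ^ 4)).card : ℝ) ≤ 2 * t ^ 4 := by
    have := one_le_pow₀ ht1 (n := 4)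
    exact (card_intIoc_le (by linarith)).trans (by linarith)
  have hnear : ((W.filter fun w => |(w.1 : ℝ) - w.2.1| ≤ t ^ 3).card : ℝ) ≤ 16 * c * t ^ 12 := by
    have hcardD : ((intIoc (-t ^ 3 - 1) (t ^ 3)).card : ℝ) ≤ 4 * t ^ 3 := by
      have := one_le_pow₀ ht1 (n := 3)
      exact (card_intIoc_le (by linarith)).trans (by linarith)
    have hcardZ : ((intIoc (2 * t ^ 5) (2 * c * t ^ 5)).card : ℝ) ≤ 2 * c * t ^ 5 := by
      have := one_le_pow₀ ht1 (n := 5)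
      exact (card_intIoc_le (by nlinarith)).trans (by linarith)
    have hle := Finset.card_le_card_of_injOn
      (s := W.filter fun w => |(w.1 : ℝ) - w.2.1| ≤ t ^ 3)
      (t := intIoc (t ^ 4) (2 * t ^ 4) ×ˢ intIoc (-t ^ 3 - 1) (t ^ 3) ×ˢ
        intIoc (2 * t ^ 5) (2 * c * t ^ 5))
      (fun w => (w.1, w.1 - w.2.1, w.2.2))
      (fun w hw => by
        obtain ⟨hw1, hw2⟩ := Finset.mem_filter.mp hw
        obtain ⟨h1, h2, h3, -⟩ := hW w hw1
        rw [abs_le] at hw2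
        simp only [Finset.coe_product, Set.mem_prod, Finset.mem_coe]
        refine ⟨h1, mem_intIoc.mpr ?_, h3⟩
        push_cast
        constructor <;> linarith)
      (fun w _ w' _ hww => by
        simp only [Prod.mk.injEq] at hww
        obtain ⟨h1, h2, h3⟩ := hww
        ext
        · exact h1
        · linarith
        · exact h3)
    rw [Finset.card_product, Finset.card_product] at hle
    calc _ ≤ ((intIoc (t ^ 4) (2 * t ^ 4)).card : ℝ) * ((intIoc (-t ^ 3 - 1) (t ^ 3)).card *
          (intIoc (2 * t ^ 5) (2 * c * t ^ 5)).card) := by exact_mod_cast hle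
      _ ≤ (2 * t ^ 4) * ((4 * t ^ 3) * (2 * c * t ^ 5)) := by gcongr
      _ = _ := by ring
  have hfar : ((W.filter fun w => ¬ |(w.1 : ℝ) - w.2.1| ≤ t ^ 3).card : ℝ) ≤ 4 * C * t ^ 12 := by
    refine (Finset.card_le_mul_card_of_fiber_le (r := C * t ^ 4)
      (T := intIoc (t ^ 4) (2 * t ^ 4) ×ˢ intIoc (t ^ 4) (2 * t ^ 4))
      (φ := fun w => (w.1, w.2.1)) (fun w hw => ?_) (fun p hp => ?_)).trans ?_
    · obtain ⟨h1, h2, -⟩ := hW w (Finset.mem_filter.mp hw).1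
      exact Finset.mem_product.mpr ⟨h1, h2⟩
    · obtain ⟨u, v⟩ := p
      obtain ⟨hu, hv⟩ := Finset.mem_product.mp hp
      simp only at hu hv
      rcases Finset.eq_empty_or_nonempty ((W.filter fun w => ¬ |(w.1 : ℝ) - w.2.1| ≤ t ^ 3).filter
        fun w => (w.1, w.2.1) = (u, v)) with hempty | ⟨w₀, hw₀⟩
      · rw [hempty, Finset.card_empty, Nat.cast_zero]
        positivity
      have huv : t ^ 3 < |(u : ℝ) - v| := by
        simp only [Finset.mem_filter, Prod.mk.injEq, not_le] at hw₀
        obtain ⟨⟨-, h1⟩, rfl, rfl⟩ := hw₀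
        exact h1
      rw [mem_intIoc] at hu hv
      have ht4 : 0 ≤ t ^ 4 := by positivity
      have hN1 : |a| * t ^ 11 ≤ |g u - g v| := by
        refine le_trans ?_ (hlow u v hu.1 hv.1)
        calc |a| * t ^ 11 = |a| * (t ^ 4) ^ 2 * t ^ 3 := by ring
          _ ≤ _ := by gcongr
      have hN2 : |g u - g v| ≤ K * t ^ 12 := by
        refine (cubic_sub_upper hg (X := 2 * t ^ 4) ?_ ?_ ?_).trans ?_
        · linarith [one_le_pow₀ ht1 (n := 4)]
        · exact abs_le.mpr ⟨by linarith, hu.2⟩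
        · exact abs_le.mpr ⟨by linarith, hv.2⟩
        · calc _ ≤ (3 * |a| + 2 * |b| + |e|) * (2 * t ^ 4) ^ 2 * t ^ 4 := by
                gcongr
                exact abs_le.mpr ⟨by linarith, by linarith⟩
            _ = _ := by rw [hK]; ring
      refine le_trans ?_ (h _ hN1 hN2 (((W.filter fun w => ¬ |(w.1 : ℝ) - w.2.1| ≤ t ^ 3).filter
        fun w => (w.1, w.2.1) = (u, v)).image fun w => w.2.2) fun z hz => ?_)
      · rw [Finset.card_image_of_injOn]
        intro w hw w' hw' hz
        simp only [Finset.coe_filter, Finset.mem_filter, Set.mem_ofPred_eq, Prod.mk.injEq] at hw hw'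
        ext
        · rw [hw.2.1, hw'.2.1]
        · rw [hw.2.2, hw'.2.2]
        · exact hz
      · obtain ⟨w, hw, rfl⟩ := Finset.mem_image.mp hz
        simp only [Finset.mem_filter, Prod.mk.injEq] at hw
        obtain ⟨⟨hw, -⟩, rfl, rfl⟩ := hw
        exact ⟨(hW w hw).2.2.1, (hW w hw).2.2.2⟩
    · rw [Finset.card_product, Nat.cast_mul]
      calc _ ≤ C * t ^ 4 * ((2 * t ^ 4) * (2 * t ^ 4)) := by gcongr
        _ = _ := by ring
  have hsplit := Finset.card_filter_add_card_filter_not (s := W)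
    (fun w => |(w.1 : ℝ) - w.2.1| ≤ t ^ 3)
  rw [← hsplit, Nat.cast_add]
  linarith

/-- Quadruples `(x, y, u, v)` with `x, y ∈ (t ^ 5, c * t ^ 5]`, `u, v ∈ (t ^ 4, 2 * t ^ 4]` and
`|f x - f y + g u - g v| < η`. -/
noncomputable def closeQuadruples (f g : ℝ → ℝ) (η c t : ℝ) : Finset (ℤ × ℤ × ℤ × ℤ) :=
  (intIoc (t ^ 5) (c * t ^ 5) ×ˢ intIoc (t ^ 5) (c * t ^ 5) ×ˢ intIoc (t ^ 4) (2 * t ^ 4) ×ˢ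
    intIoc (t ^ 4) (2 * t ^ 4)).filter fun s => |f s.1 - f s.2.1 + g s.2.2.1 - g s.2.2.2| < η

theorem mem_closeQuadruples {f g : ℝ → ℝ} {η c t : ℝ} {s : ℤ × ℤ × ℤ × ℤ} :
    s ∈ closeQuadruples f g η c t ↔ s.1 ∈ intIoc (t ^ 5) (c * t ^ 5) ∧
      s.2.1 ∈ intIoc (t ^ 5) (c * t ^ 5) ∧ s.2.2.1 ∈ intIoc (t ^ 4) (2 * t ^ 4) ∧
      s.2.2.2 ∈ intIoc (t ^ 4) (2 * t ^ 4) ∧ |f s.1 - f s.2.1 + g s.2.2.1 - g s.2.2.2| < η := by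
  simp [closeQuadruples, and_assoc]

/-- Distinct large integers have well separated values under a real cubic. -/
theorem eventually_eq_of_cubic_sub_lt {a b e k : ℝ} (ha : a ≠ 0) {g : ℝ → ℝ}
    (hg : ∀ x, g x = a * x ^ 3 + b * x ^ 2 + e * x + k) (θ : ℝ) :
    ∀ᶠ X : ℝ in Filter.atTop, ∀ u v : ℤ, X < u → X < v → |g u - g v| < θ → u = v := by
  have ha' : 0 < |a| := abs_pos.mpr ha
  filter_upwards [cubic_sub_lower ha hg, Filter.eventually_ge_atTop 1,
    Filter.eventually_ge_atTop (θ / |a|)] with X hlow h1 h2 u v hu hv huv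
  by_contra hne
  rw [div_le_iff₀ ha'] at h2
  have hone : (1 : ℝ) ≤ |(u : ℝ) - v| := by
    exact_mod_cast Int.one_le_abs (sub_ne_zero.mpr hne)
  have h3 := hlow u v hu hv
  have h4 : θ ≤ |a| * X ^ 2 * |(u : ℝ) - v| := by
    calc θ ≤ |a| * X * 1 := by linarith
      _ ≤ |a| * X ^ 2 * |(u : ℝ) - v| := by
        gcongr
        exact le_self_pow₀ h1 (by norm_num)
  linarith

theorem closeQuadruples_sub_le {f g : ℝ → ℝ} {η c a₁ b₁ e₁ k₁ a₂ b₂ e₂ k₂ : ℝ}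
    (hη : 0 < η) (ha₁ : a₁ ≠ 0) (hf : ∀ x, f x = a₁ * x ^ 3 + b₁ * x ^ 2 + e₁ * x + k₁)
    (hg : ∀ x, g x = a₂ * x ^ 3 + b₂ * x ^ 2 + e₂ * x + k₂) :
    ∃ K : ℝ, 0 < K ∧ ∀ᶠ t : ℝ in Filter.atTop, ∀ s ∈ closeQuadruples f g η c t,
      |(s.1 : ℝ) - s.2.1| ≤ K * t ^ 2 := by
  have ha' : 0 < |a₁| := abs_pos.mpr ha₁
  set A : ℝ := 3 * |a₂| + 2 * |b₂| + |e₂| with hA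
  have hA0 : 0 ≤ A := by positivity
  refine ⟨(η + 4 * A) / |a₁|, by positivity, ?_⟩
  filter_upwards [Filter.eventually_ge_atTop 1,
    (Filter.tendsto_pow_atTop (α := ℝ) (by norm_num : 5 ≠ 0)).eventually (cubic_sub_lower ha₁ hf)]
    with t ht1 hlow s hs
  obtain ⟨hx, hy, hu, hv, h⟩ := mem_closeQuadruples.mp hs
  rw [mem_intIoc] at hx hy hu hv
  have h1 := hlow _ _ hx.1 hy.1
  have ht4 : 0 ≤ t ^ 4 := by positivity
  have h2 : |g s.2.2.1 - g s.2.2.2| ≤ 4 * A * t ^ 12 := by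
    refine (cubic_sub_upper hg (X := 2 * t ^ 4) ?_ ?_ ?_).trans ?_
    · linarith [one_le_pow₀ ht1 (n := 4)]
    · exact abs_le.mpr ⟨by linarith, hu.2⟩
    · exact abs_le.mpr ⟨by linarith, hv.2⟩
    · calc _ ≤ A * (2 * t ^ 4) ^ 2 * t ^ 4 := by
            gcongr
            exact abs_le.mpr ⟨by linarith, by linarith⟩
        _ = _ := by ring
  have h3 : |f s.1 - f s.2.1| ≤ η + 4 * A * t ^ 12 := by
    rw [abs_lt] at h
    rw [abs_le] at h2 ⊢
    constructor <;> linarith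
  have h4 : η ≤ η * t ^ 12 := le_mul_of_one_le_right hη.le (one_le_pow₀ ht1)
  rw [div_mul_eq_mul_div, le_div_iff₀ ha']
  refine le_of_mul_le_mul_left ?_ (by positivity : 0 < t ^ 10)
  calc _ = |a₁| * (t ^ 5) ^ 2 * |(s.1 : ℝ) - s.2.1| := by ring
    _ ≤ (η + 4 * A) * t ^ 12 := by linarith
    _ = _ := by ring

/-- A finite set whose elements carry a nonzero integer divisor of a fixed `n`, which determines
the element, has at most `2 d(n)` elements. -/
theorem card_le_two_mul_card_divisors {ι : Type*} {S : Finset ι} {n : ℤ} (hn : n ≠ 0) {δ : ι → ℤ}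
    (hδ : ∀ s ∈ S, δ s ∣ n) (hinj : Set.InjOn δ S) :
    S.card ≤ 2 * n.natAbs.divisors.card := by
  have hle := Finset.card_le_card_of_injOn (s := S)
    (t := n.natAbs.divisors ×ˢ (Finset.univ : Finset Bool))
    (fun s => ((δ s).natAbs, decide (0 < δ s)))
    (fun s hs => by
      simpa [Int.natAbs_dvd_natAbs, hn, lt_or_ge] using hδ s hs)
    (fun s hs s' hs' h => by
      refine hinj hs hs' ?_
      simp only [Prod.mk.injEq, decide_eq_decide] at h
      have h0 : δ s ≠ 0 := fun h0 => hn (by simpa [h0] using hδ s hs)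
      have h0' : δ s' ≠ 0 := fun h0 => hn (by simpa [h0] using hδ s' hs')
      omega)
  rw [Finset.card_product] at hle
  simpa [mul_comm] using hle

theorem card_offDiag_pairs_le {f g : ℝ → ℝ} {η c K a₁ b₁ e₁ k₁ a₂ b₂ e₂ k₂ : ℝ} (hη : 0 < η)
    (hc : 1 < c) (ha₁ : a₁ ≠ 0) (hf : ∀ x, f x = a₁ * x ^ 3 + b₁ * x ^ 2 + e₁ * x + k₁)
    (ha₂ : a₂ ≠ 0) (hg : ∀ x, g x = a₂ * x ^ 3 + b₂ * x ^ 2 + e₂ * x + k₂) (hK : 0 < K)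
    (hsub : ∀ᶠ t : ℝ in Filter.atTop, ∀ s ∈ closeQuadruples f g η c t,
      |(s.1 : ℝ) - s.2.1| ≤ K * t ^ 2) :
    ∃ C : ℝ, 0 < C ∧ ∀ᶠ t : ℝ in Filter.atTop, ∀ R : ℝ, 0 ≤ R →
      (∀ n : ℕ, n ≠ 0 → (n : ℝ) ≤ K * c * t ^ 7 → (n.divisors.card : ℝ) ≤ R) →
      ∀ E : Finset ((ℤ × ℤ × ℤ × ℤ) × (ℤ × ℤ × ℤ × ℤ)),
      (∀ q ∈ E, q.1 ∈ closeQuadruples f g η c t ∧ q.2 ∈ closeQuadruples f g η c t ∧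
        q.1.1 ≠ q.1.2.1 ∧ q.1.1 - q.1.2.1 = q.2.1 - q.2.2.1 ∧ q.1.2.2.2 = q.2.2.2.2 ∧
        q.1 ≠ q.2) →
      (E.card : ℝ) ≤ C * R * t ^ 12 := by
  classical
  have hα : 3 * a₁ ≠ 0 := by positivity
  have hα' : 0 < |3 * a₁| := abs_pos.mpr hα
  obtain ⟨C, hC, htriples⟩ := card_triples_near_hyperbola_le hα (2 * b₁) hc hη ha₂ hg
  refine ⟨2 * C, by positivity, ?_⟩
  filter_upwards [htriples, hsub, Filter.eventually_ge_atTop 1,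
    linear_form_bounds hα (2 * b₁) c, Filter.eventually_ge_atTop (4 * η / |3 * a₁|),
    (Filter.tendsto_pow_atTop (α := ℝ) (by norm_num : 4 ≠ 0)).eventually
      (eventually_eq_of_cubic_sub_lt ha₂ hg (2 * η))]
    with t htriples hsub ht1 hlin ht2 hsep R hR hdiv E hE
  rw [div_le_iff₀ hα'] at ht2
  have hw4 : ∀ z ∈ intIoc (2 * t ^ 5) (2 * c * t ^ 5), 4 * η ≤ |3 * a₁ * (z : ℝ) + 2 * b₁| := by
    intro z hz
    refine le_trans ?_ (hlin z hz).1
    have : t ≤ t ^ 5 := le_self_pow₀ ht1 (by norm_num)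
    nlinarith
  set π : (ℤ × ℤ × ℤ × ℤ) × (ℤ × ℤ × ℤ × ℤ) → ℤ × ℤ × ℤ :=
    fun q => (q.1.2.2.1, q.2.2.2.1, q.1.1 + q.2.2.1) with hπ
  set ν : (ℤ × ℤ × ℤ × ℤ) × (ℤ × ℤ × ℤ × ℤ) → ℤ :=
    fun q => (q.1.1 - q.1.2.1) * (q.2.2.1 - q.1.2.1) with hν
  have hz : ∀ q ∈ E, (π q).2.2 ∈ intIoc (2 * t ^ 5) (2 * c * t ^ 5) := by
    intro q hq
    obtain ⟨h1, h2, -⟩ := hE q hq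
    have hx := mem_intIoc.mp (mem_closeQuadruples.mp h1).1
    have hy := mem_intIoc.mp (mem_closeQuadruples.mp h2).2.1
    rw [mem_intIoc]
    simp only [hπ]
    push_cast
    constructor <;> linarith
  have hnear : ∀ q ∈ E, |ν q * (3 * a₁ * (π q).2.2 + 2 * b₁) - (g (π q).1 - g (π q).2.1)|
      < 2 * η := by
    intro q hq
    obtain ⟨h1, h2, -, hd, hv, -⟩ := hE q hq
    have q1 := (mem_closeQuadruples.mp h1).2.2.2.2
    have q2 := (mem_closeQuadruples.mp h2).2.2.2.2
    have hd' : (q.2.1 : ℝ) = q.1.1 - q.1.2.1 + q.2.2.1 := by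
      have : q.2.1 = q.1.1 - q.1.2.1 + q.2.2.1 := by linarith
      exact_mod_cast this
    have hid : (ν q : ℝ) * (3 * a₁ * (π q).2.2 + 2 * b₁) - (g (π q).1 - g (π q).2.1)
        = (f q.2.1 - f q.2.2.1 + g q.2.2.2.1 - g q.2.2.2.2)
          - (f q.1.1 - f q.1.2.1 + g q.1.2.2.1 - g q.1.2.2.2) := by
      simp only [hν, hπ, hf, hv, hd']
      push_cast
      ring
    rw [hid, abs_lt]
    rw [abs_lt] at q1 q2
    constructor <;> linarith
  have hν0 : ∀ q ∈ E, ν q ≠ 0 := by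
    intro q hq
    obtain ⟨h1, h2, hxy, hd, hv, hne⟩ := hE q hq
    obtain ⟨-, -, hu1, -⟩ := mem_closeQuadruples.mp h1
    obtain ⟨-, -, hu2, -⟩ := mem_closeQuadruples.mp h2
    refine mul_ne_zero (sub_ne_zero.mpr hxy) fun h0 => hne ?_
    have hn := hnear q hq
    simp only [hν, h0, hπ, mul_zero, Int.cast_zero, zero_mul, zero_sub, abs_neg] at hn
    have hu := hsep _ _ (mem_intIoc.mp hu1).1 (mem_intIoc.mp hu2).1 hn
    ext
    · linarith
    · linarith
    · exact hu
    · exact hv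
  have hfiber : ∀ p ∈ E.image π, ((E.filter (π · = p)).card : ℝ) ≤ 2 * R := by
    intro p hp
    obtain ⟨q₀, hq₀, rfl⟩ := Finset.mem_image.mp hp
    have hνeq : ∀ q ∈ E.filter (π · = π q₀), ν q = ν q₀ := by
      intro q hq
      obtain ⟨hq, hπq⟩ := Finset.mem_filter.mp hq
      have n1 := hnear q hq
      have n2 := hnear q₀ hq₀
      have hw := hw4 _ (hz q₀ hq₀)
      rw [hπq] at n1
      by_contra hne
      have hone : (1 : ℝ) ≤ |(ν q : ℝ) - ν q₀| := by
        exact_mod_cast Int.one_le_abs (sub_ne_zero.mpr hne)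
      have hlt : |((ν q : ℝ) - ν q₀) * (3 * a₁ * (π q₀).2.2 + 2 * b₁)| < 4 * η := by
        rw [abs_lt] at n1 n2 ⊢
        constructor <;> linarith
      rw [abs_mul] at hlt
      nlinarith [abs_nonneg (3 * a₁ * ((π q₀).2.2 : ℝ) + 2 * b₁)]
    have hle : (E.filter (π · = π q₀)).card ≤ 2 * (ν q₀).natAbs.divisors.card := by
      refine card_le_two_mul_card_divisors (hν0 q₀ hq₀) (δ := fun q => q.1.1 - q.1.2.1)
        (fun q hq => hνeq q hq ▸ dvd_mul_right _ _) fun q hq q' hq' hqq => ?_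
      have hν1 : ν q = ν q' := (hνeq q hq).trans (hνeq q' hq').symm
      obtain ⟨hq, hπq⟩ := Finset.mem_filter.mp hq
      obtain ⟨hq', hπq'⟩ := Finset.mem_filter.mp hq'
      have hπ1 := hπq.trans hπq'.symm
      simp only [hπ, Prod.mk.injEq] at hπ1
      obtain ⟨p1, p2, p3⟩ := hπ1
      simp only at hqq
      simp only [hν] at hν1
      obtain ⟨h1, h2, hxy, hd, hv, -⟩ := hE q hq
      obtain ⟨h1', h2', -, hd', hv', -⟩ := hE q' hq'
      rw [← hqq] at hν1
      have hy := mul_left_cancel₀ (sub_ne_zero.mpr hxy) hν1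
      have e1 : q.1.1 = q'.1.1 := by linarith
      have e2 : q.1.2.1 = q'.1.2.1 := by linarith
      have e3 : q.2.1 = q'.2.1 := by linarith
      have e4 : q.2.2.1 = q'.2.2.1 := by linarith
      obtain ⟨-, -, -, m, i⟩ := mem_closeQuadruples.mp h1
      obtain ⟨-, -, -, m', i'⟩ := mem_closeQuadruples.mp h1'
      have hvv : q.1.2.2.2 = q'.1.2.2.2 := by
        refine hsep _ _ (mem_intIoc.mp m).1 (mem_intIoc.mp m').1 ?_
        rw [e1, e2, p1] at i
        rw [abs_lt] at i i' ⊢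
        constructor <;> linarith
      have hvv' : q.2.2.2.2 = q'.2.2.2.2 := by rw [← hv, ← hv', hvv]
      ext <;> assumption
    refine le_trans (by exact_mod_cast hle : _ ≤ ((2 * (ν q₀).natAbs.divisors.card : ℕ) : ℝ)) ?_
    push_cast
    gcongr
    refine hdiv _ (Int.natAbs_ne_zero.mpr (hν0 q₀ hq₀)) ?_
    obtain ⟨h1, h2, -⟩ := hE q₀ hq₀
    have hs := hsub _ h1
    have hy := mem_intIoc.mp (mem_closeQuadruples.mp h1).2.1
    have hy' := mem_intIoc.mp (mem_closeQuadruples.mp h2).2.1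
    have ht5 : 0 ≤ t ^ 5 := by positivity
    have hyy : |(q₀.2.2.1 : ℝ) - q₀.1.2.1| ≤ c * t ^ 5 :=
      abs_le.mpr ⟨by linarith, by linarith⟩
    rw [Nat.cast_natAbs, Int.cast_abs]
    simp only [hν]
    push_cast
    rw [abs_mul]
    calc _ ≤ K * t ^ 2 * (c * t ^ 5) := by gcongr
      _ = _ := by ring
  have himage : ((E.image π).card : ℝ) ≤ C * t ^ 12 := by
    refine htriples _ fun w hw => ?_
    obtain ⟨q, hq, rfl⟩ := Finset.mem_image.mp hw
    obtain ⟨h1, h2, -⟩ := hE q hq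
    exact ⟨(mem_closeQuadruples.mp h1).2.2.1, (mem_closeQuadruples.mp h2).2.2.1, hz q hq,
      ν q, hnear q hq⟩
  calc (E.card : ℝ) ≤ 2 * R * (E.image π).card :=
        Finset.card_le_mul_card_of_fiber_le (fun q hq => Finset.mem_image_of_mem π hq) hfiber
    _ ≤ 2 * R * (C * t ^ 12) := by gcongr
    _ = _ := by ring

theorem card_diag_closeQuadruples_le (f : ℝ → ℝ) {g : ℝ → ℝ} {η c a b e k : ℝ} (hc : 1 < c)
    (ha : a ≠ 0) (hg : ∀ x, g x = a * x ^ 3 + b * x ^ 2 + e * x + k) :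
    ∀ᶠ t : ℝ in Filter.atTop,
      (((closeQuadruples f g η c t).filter fun s => s.1 = s.2.1).card : ℝ) ≤ 2 * c * t ^ 9 := by
  filter_upwards [Filter.eventually_ge_atTop 1,
    (Filter.tendsto_pow_atTop (α := ℝ) (by norm_num : 4 ≠ 0)).eventually
      (eventually_eq_of_cubic_sub_lt ha hg η)] with t ht1 hsep
  have hcardJ : ((intIoc (t ^ 4) (2 * t ^ 4)).card : ℝ) ≤ 2 * t ^ 4 := by
    have := one_le_pow₀ ht1 (n := 4)
    exact (card_intIoc_le (by linarith)).trans (by linarith)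
  have hcardI : ((intIoc (t ^ 5) (c * t ^ 5)).card : ℝ) ≤ c * t ^ 5 := by
    have := one_le_pow₀ ht1 (n := 5)
    exact (card_intIoc_le (by nlinarith)).trans (by linarith)
  have hle := Finset.card_le_card_of_injOn
    (s := (closeQuadruples f g η c t).filter fun s => s.1 = s.2.1)
    (t := intIoc (t ^ 5) (c * t ^ 5) ×ˢ intIoc (t ^ 4) (2 * t ^ 4))
    (fun s => (s.1, s.2.2.1))
    (fun s hs => by
      obtain ⟨h1, -, h2, -⟩ := mem_closeQuadruples.mp (Finset.mem_filter.mp hs).1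
      exact Finset.mem_product.mpr ⟨h1, h2⟩)
    (fun s hs s' hs' hss => by
      have huv : ∀ s ∈ (closeQuadruples f g η c t).filter fun s => s.1 = s.2.1,
          s.2.2.1 = s.2.2.2 := fun s hs => by
        obtain ⟨h1, h2⟩ := Finset.mem_filter.mp hs
        obtain ⟨-, -, hu, hv, h⟩ := mem_closeQuadruples.mp h1
        rw [h2, sub_self, zero_add] at h
        exact hsep _ _ (mem_intIoc.mp hu).1 (mem_intIoc.mp hv).1 h
      have u1 := huv s hs
      have u2 := huv s' hs'
      have x1 := (Finset.mem_filter.mp hs).2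
      have x2 := (Finset.mem_filter.mp hs').2
      simp only [Prod.mk.injEq] at hss
      ext
      · exact hss.1
      · rw [← x1, ← x2, hss.1]
      · exact hss.2
      · rw [← u1, ← u2, hss.2])
  rw [Finset.card_product] at hle
  calc _ ≤ ((intIoc (t ^ 5) (c * t ^ 5)).card : ℝ) * (intIoc (t ^ 4) (2 * t ^ 4)).card := by
        exact_mod_cast hle
    _ ≤ (c * t ^ 5) * (2 * t ^ 4) := by gcongr
    _ = _ := by ring

theorem le_mul_of_sq_le_mul_add {M N X s : ℝ} (hM : 1 ≤ M) (hN : 0 ≤ N) (hX : 0 < X)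
    (h : s ^ 2 ≤ M * X * s + N * X ^ 2) : s ≤ (M + N) * X := by
  by_contra! hlt
  have hXs : X ≤ s := by nlinarith [mul_nonneg hN hX.le]
  have h1 : N * X * X ≤ N * X * s := by gcongr
  nlinarith [mul_lt_mul_of_pos_right hlt (hX.trans_le hXs)]

theorem card_closeQuadruples_le {f g : ℝ → ℝ} {η c ε a₁ b₁ e₁ k₁ a₂ b₂ e₂ k₂ : ℝ} (hη : 0 < η)
    (hc : 1 < c) (hε : 0 < ε) (ha₁ : a₁ ≠ 0)
    (hf : ∀ x, f x = a₁ * x ^ 3 + b₁ * x ^ 2 + e₁ * x + k₁)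
    (ha₂ : a₂ ≠ 0) (hg : ∀ x, g x = a₂ * x ^ 3 + b₂ * x ^ 2 + e₂ * x + k₂) :
    ∃ C : ℝ, 0 < C ∧ ∀ᶠ t : ℝ in Filter.atTop,
      ((closeQuadruples f g η c t).card : ℝ) ≤ C * (t ^ 9 * t ^ ε) := by
  classical
  obtain ⟨K, hK, hsub⟩ := closeQuadruples_sub_le (c := c) hη ha₁ hf hg
  obtain ⟨C, hC, hpairs⟩ := card_offDiag_pairs_le hη hc ha₁ hf ha₂ hg hK hsub
  obtain ⟨B, hB, hdiv⟩ := exists_card_divisors_le_mul_rpow (by positivity : 0 < 2 * ε / 7)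
  set L : ℝ := B * (K * c) ^ (2 * ε / 7) with hL
  have hL0 : 0 < L := by positivity
  set M : ℝ := 4 * K + 4 with hM
  refine ⟨2 * c + M + M * C * L, by positivity, ?_⟩
  filter_upwards [hsub, hpairs, Filter.eventually_ge_atTop 1,
    card_diag_closeQuadruples_le (η := η) f hc ha₂ hg] with t hsub hpairs ht1 hdiag
  have ht0 : 0 < t := by linarith
  have hcardJ : ((intIoc (t ^ 4) (2 * t ^ 4)).card : ℝ) ≤ 2 * t ^ 4 := by
    have := one_le_pow₀ ht1 (n := 4)
    exact (card_intIoc_le (by linarith)).trans (by linarith)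
  have htε : 1 ≤ t ^ ε := Real.one_le_rpow ht1 hε.le
  set S := (closeQuadruples f g η c t).filter fun s => ¬ s.1 = s.2.1 with hS
  set T := intIoc (-(K * t ^ 2) - 1) (K * t ^ 2) ×ˢ intIoc (t ^ 4) (2 * t ^ 4) with hT
  have hcardT : (T.card : ℝ) ≤ M * t ^ 6 := by
    have h2 := one_le_pow₀ ht1 (n := 2)
    have h3 : 0 < K * t ^ 2 := by positivity
    have hcardD : ((intIoc (-(K * t ^ 2) - 1) (K * t ^ 2)).card : ℝ) ≤ (2 * K + 2) * t ^ 2 :=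
      (card_intIoc_le (by linarith)).trans (by linarith)
    rw [hT, Finset.card_product, Nat.cast_mul]
    calc _ ≤ ((2 * K + 2) * t ^ 2) * (2 * t ^ 4) := by gcongr
      _ = _ := by rw [hM]; ring
  have hmaps : ∀ s ∈ S, (s.1 - s.2.1, s.2.2.2) ∈ T := fun s hs => by
    have h1 := (Finset.mem_filter.mp hs).1
    have h2 := abs_le.mp (hsub s h1)
    refine Finset.mem_product.mpr ⟨mem_intIoc.mpr ?_, (mem_closeQuadruples.mp h1).2.2.2.1⟩
    push_cast
    constructor <;> linarith
  set R : ℝ := L * t ^ (2 * ε) with hR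
  have hR0 : 0 ≤ R := by positivity
  have hdivR : ∀ n : ℕ, n ≠ 0 → (n : ℝ) ≤ K * c * t ^ 7 → (n.divisors.card : ℝ) ≤ R := by
    intro n hn hle
    have hsplit : (K * c * t ^ 7) ^ (2 * ε / 7) = (K * c) ^ (2 * ε / 7) * t ^ (2 * ε) := by
      rw [Real.mul_rpow (by positivity) (by positivity), ← Real.rpow_natCast t 7,
        ← Real.rpow_mul ht0.le]
      congr 2
      push_cast
      ring
    calc (n.divisors.card : ℝ) ≤ B * (n : ℝ) ^ (2 * ε / 7) := hdiv n hn
      _ ≤ B * (K * c * t ^ 7) ^ (2 * ε / 7) := by gcongr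
      _ = R := by rw [hsplit, hR, hL]; ring
  set Q := (S ×ˢ S).filter fun q => (q.1.1 - q.1.2.1, q.1.2.2.2) = (q.2.1 - q.2.2.1, q.2.2.2.2)
    with hQ
  have hQeq : ((Q.filter fun q => q.1 = q.2).card : ℝ) ≤ S.card := by
    refine Nat.cast_le.mpr (Finset.card_le_card_of_injOn Prod.fst (fun q hq => ?_) ?_)
    · exact (Finset.mem_product.mp (Finset.mem_filter.mp (Finset.mem_filter.mp hq).1).1).1
    · intro q hq q' hq' h
      have h1 := (Finset.mem_filter.mp hq).2
      have h2 := (Finset.mem_filter.mp hq').2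
      exact Prod.ext h (by rw [← h1, ← h2, h])
  have hQne : ((Q.filter fun q => ¬ q.1 = q.2).card : ℝ) ≤ C * R * t ^ 12 := by
    refine hpairs R hR0 hdivR _ fun q hq => ?_
    obtain ⟨h1, hne⟩ := Finset.mem_filter.mp hq
    obtain ⟨h1, h2⟩ := Finset.mem_filter.mp h1
    obtain ⟨m1, m2⟩ := Finset.mem_product.mp h1
    obtain ⟨m1, d1⟩ := Finset.mem_filter.mp m1
    rw [Prod.mk.injEq] at h2
    exact ⟨m1, (Finset.mem_filter.mp m2).1, d1, h2.1, h2.2, hne⟩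
  have hQcard : (Q.card : ℝ) ≤ S.card + C * R * t ^ 12 := by
    rw [← Finset.card_filter_add_card_filter_not (s := Q) (fun q => q.1 = q.2), Nat.cast_add]
    linarith
  have hcs : (S.card : ℝ) ^ 2 ≤ T.card * Q.card := by
    exact_mod_cast Finset.card_sq_le_card_mul_card_filter hmaps
  set X : ℝ := t ^ 9 * t ^ ε with hX
  have hX0 : 0 < X := by positivity
  have hX9 : t ^ 9 ≤ X := le_mul_of_one_le_right (by positivity) htε
  have hX6 : t ^ 6 ≤ X := (pow_le_pow_right₀ ht1 (by norm_num)).trans hX9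
  have hX2 : t ^ 6 * (t ^ (2 * ε) * t ^ 12) = X ^ 2 := by
    rw [hX, mul_pow, ← Real.rpow_natCast (t ^ ε) 2, ← Real.rpow_mul ht0.le]
    push_cast
    rw [mul_comm ε 2]
    ring
  have hM0 : 0 < M := by positivity
  have hSbound : (S.card : ℝ) ≤ (M + M * C * L) * X := by
    have h1 : (S.card : ℝ) ^ 2 ≤ M * X * S.card + M * C * L * X ^ 2 := by
      calc (S.card : ℝ) ^ 2 ≤ (M * t ^ 6) * (S.card + C * R * t ^ 12) :=
            hcs.trans (by gcongr)
        _ = M * t ^ 6 * S.card + M * C * L * (t ^ 6 * (t ^ (2 * ε) * t ^ 12)) := by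
            rw [hR]; ring
        _ ≤ _ := by rw [hX2]; gcongr
    have hMCL : 0 < M * C * L := by positivity
    exact le_mul_of_sq_le_mul_add (by linarith) hMCL.le hX0 h1
  rw [← Finset.card_filter_add_card_filter_not (s := closeQuadruples f g η c t)
    (fun s => s.1 = s.2.1), Nat.cast_add]
  have : 2 * c * t ^ 9 ≤ 2 * c * X := by gcongr
  linarith


/-- **Fourth moment estimate for general cubic polynomials (Lemma 2.3).**
For cubic polynomials `h₁, h₂ ∈ ℝ[x]` and fixed `c > 1`, the number of
integral solutions of `|h₁(x₁) - h₁(y₁) + h₂(x₂) - h₂(y₂)| < η` with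
`P < x₁, y₁ ≤ cP` and `P^{4/5} < x₂, y₂ ≤ 2P^{4/5}` is `O(P^{9/5+ε})`. -/
theorem fourth_moment_cubic_polynomials
    (η : ℝ) (hη : 0 < η) (h₁ h₂ : Polynomial ℝ)
    (hdeg₁ : h₁.degree = 3) (hdeg₂ : h₂.degree = 3)
    (c : ℝ) (hc : 1 < c) (ε : ℝ) (hε : 0 < ε) :
    ∃ C : ℝ, 0 < C ∧ ∀ P : ℝ, 2 ≤ P →
      (Nat.card {v : ℤ × ℤ × ℤ × ℤ //
          P < (v.1 : ℝ) ∧ (v.1 : ℝ) ≤ c * P ∧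
          P < (v.2.1 : ℝ) ∧ (v.2.1 : ℝ) ≤ c * P ∧
          P ^ ((4:ℝ)/5) < (v.2.2.1 : ℝ) ∧ (v.2.2.1 : ℝ) ≤ 2 * P ^ ((4:ℝ)/5) ∧
          P ^ ((4:ℝ)/5) < (v.2.2.2 : ℝ) ∧ (v.2.2.2 : ℝ) ≤ 2 * P ^ ((4:ℝ)/5) ∧
          |h₁.eval ((v.1 : ℝ)) - h₁.eval ((v.2.1 : ℝ)) +
            h₂.eval ((v.2.2.1 : ℝ)) - h₂.eval ((v.2.2.2 : ℝ))| < η} : ℝ)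
        ≤ C * P ^ (9/5 + ε : ℝ) := by
  obtain ⟨a₁, b₁, e₁, k₁, ha₁, hf⟩ := Polynomial.exists_eval_eq_of_degree_eq_three hdeg₁
  obtain ⟨a₂, b₂, e₂, k₂, ha₂, hg⟩ := Polynomial.exists_eval_eq_of_degree_eq_three hdeg₂
  obtain ⟨C, hC, hev⟩ := card_closeQuadruples_le hη hc (by positivity : 0 < 5 * ε) ha₁ hf ha₂ hg
  obtain ⟨T, hT⟩ := Filter.eventually_atTop.mp hev
  refine ⟨C + 4 * c ^ 2 * |T| ^ 18, by positivity, fun P hP => ?_⟩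
  have hP0 : 0 < P := by linarith
  set t : ℝ := P ^ ((1 : ℝ) / 5) with ht
  have ht1 : 1 ≤ t := Real.one_le_rpow (by linarith) (by norm_num)
  have ht0 : 0 < t := by linarith
  have ht5 : t ^ 5 = P := by
    rw [ht, ← Real.rpow_natCast, ← Real.rpow_mul hP0.le]
    norm_num
  have ht4 : P ^ ((4 : ℝ) / 5) = t ^ 4 := by
    rw [ht, ← Real.rpow_natCast, ← Real.rpow_mul hP0.le]
    norm_num
  have hpow : P ^ (9 / 5 + ε : ℝ) = t ^ 9 * t ^ (5 * ε) := by
    rw [ht, ← Real.rpow_natCast, ← Real.rpow_mul hP0.le, ← Real.rpow_mul hP0.le,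
      ← Real.rpow_add hP0]
    congr 1
    push_cast
    ring
  have hpow1 : 1 ≤ t ^ 9 * t ^ (5 * ε) :=
    one_le_mul_of_one_le_of_one_le (one_le_pow₀ ht1) (Real.one_le_rpow ht1 (by positivity))
  rw [hpow, ht4, ← ht5, Nat.subtype_card (closeQuadruples h₁.eval h₂.eval η c t) fun s => by
    simp only [mem_closeQuadruples, mem_intIoc, and_assoc]]
  rcases le_or_gt T t with hTt | hTt
  · refine (hT t hTt).trans ?_
    gcongr
    exact le_add_of_nonneg_right (by positivity)
  · have hcardI : ((intIoc (t ^ 5) (c * t ^ 5)).card : ℝ) ≤ c * t ^ 5 := by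
      have := one_le_pow₀ ht1 (n := 5)
      exact (card_intIoc_le (by nlinarith)).trans (by linarith)
    have hcardJ : ((intIoc (t ^ 4) (2 * t ^ 4)).card : ℝ) ≤ 2 * t ^ 4 := by
      have := one_le_pow₀ ht1 (n := 4)
      exact (card_intIoc_le (by linarith)).trans (by linarith)
    have hle : (closeQuadruples h₁.eval h₂.eval η c t).card ≤ _ := Finset.card_filter_le _ _
    rw [Finset.card_product, Finset.card_product, Finset.card_product] at hle
    have htT : t ≤ |T| := hTt.le.trans (le_abs_self T)
    calc _ ≤ ((intIoc (t ^ 5) (c * t ^ 5)).card : ℝ) * ((intIoc (t ^ 5) (c * t ^ 5)).card *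
          ((intIoc (t ^ 4) (2 * t ^ 4)).card * (intIoc (t ^ 4) (2 * t ^ 4)).card)) := by
            exact_mod_cast hle
      _ ≤ (c * t ^ 5) * ((c * t ^ 5) * ((2 * t ^ 4) * (2 * t ^ 4))) := by gcongr
      _ = 4 * c ^ 2 * t ^ 18 := by ring
      _ ≤ 4 * c ^ 2 * |T| ^ 18 := by gcongr
      _ ≤ C + 4 * c ^ 2 * |T| ^ 18 := by linarith
      _ ≤ _ := le_mul_of_one_le_right (by positivity) hpow1
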